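/- For every cellular automaton F on a closed σ-invariant set X ⊆ A^ℤ, every x ∈ X and every n ≥ 1, one has Λₙ⁺(x) ≥ Iₙ⁺(x) − 1 and Λₙ⁻(x) ≥ Iₙ⁻(x) − 1. -/

import Mathlib

open MeasureTheory Filter Topology Set

noncomputable section

/-- The shift map `σ` on `ℤ → A`, defined by `(σ x) i = x (i + 1)`. -/
def shiftMap (A : Type*) : (ℤ → A) → (ℤ → A) := fun x i => x (i + 1)

/-- The iterate `σ^j` of the shift, for `j : ℤ`: `(σ^j x) i = x (i + j)`. -/
def shiftIter {A : Type*} (j : ℤ) (x : ℤ → A) : ℤ → A := fun i => x (i + j)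

/-- `F` admits a local rule of radius `r`:
`F(x)_i = f (x_{i-r}, …, x_{i+r})` for a block map `f : A^{2r+1} → A`. -/
def HasLocalRule {A : Type*} (F : (ℤ → A) → (ℤ → A)) (r : ℕ) : Prop :=
  ∃ f : (Fin (2 * r + 1) → A) → A, ∀ (x : ℤ → A) (i : ℤ),
    F x i = f fun j => x (i - (r : ℤ) + ((j : ℕ) : ℤ))

/-- `W_s⁺(x) = {y ∈ X : y_i = x_i for all i ≥ s}`. -/
def Wplus {A : Type*} (X : Set (ℤ → A)) (s : ℤ) (x : ℤ → A) : Set (ℤ → A) :=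
  {y ∈ X | ∀ i : ℤ, s ≤ i → y i = x i}

/-- `W_s⁻(x) = {y ∈ X : y_i = x_i for all i ≤ s}`. -/
def Wminus {A : Type*} (X : Set (ℤ → A)) (s : ℤ) (x : ℤ → A) : Set (ℤ → A) :=
  {y ∈ X | ∀ i : ℤ, i ≤ s → y i = x i}

/-- `Λ̃ₙ⁺(x) = min{s ≥ 0 : F^i(W₀⁺(x)) ⊆ W_s⁺(F^i(x)) for all 1 ≤ i ≤ n}`. -/
def lamTildeP {A : Type*} (X : Set (ℤ → A)) (F : (ℤ → A) → (ℤ → A)) (n : ℕ)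
    (x : ℤ → A) : ℕ :=
  sInf {s : ℕ | ∀ i : ℕ, 1 ≤ i → i ≤ n →
    F^[i] '' Wplus X 0 x ⊆ Wplus X (s : ℤ) (F^[i] x)}

/-- `Λ̃ₙ⁻(x) = min{s ≥ 0 : F^i(W₀⁻(x)) ⊆ W_{-s}⁻(F^i(x)) for all 1 ≤ i ≤ n}`. -/
def lamTildeM {A : Type*} (X : Set (ℤ → A)) (F : (ℤ → A) → (ℤ → A)) (n : ℕ)
    (x : ℤ → A) : ℕ :=
  sInf {s : ℕ | ∀ i : ℕ, 1 ≤ i → i ≤ n →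
    F^[i] '' Wminus X 0 x ⊆ Wminus X (-(s : ℤ)) (F^[i] x)}

/-- `Λₙ⁺(x) = max_{j ∈ ℤ} Λ̃ₙ⁺(σ^j x)`. -/
def lamP {A : Type*} (X : Set (ℤ → A)) (F : (ℤ → A) → (ℤ → A)) (n : ℕ)
    (x : ℤ → A) : ℕ :=
  sSup (Set.range fun j : ℤ => lamTildeP X F n (shiftIter j x))

/-- `Λₙ⁻(x) = max_{j ∈ ℤ} Λ̃ₙ⁻(σ^j x)`. -/
def lamM {A : Type*} (X : Set (ℤ → A)) (F : (ℤ → A) → (ℤ → A)) (n : ℕ)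
    (x : ℤ → A) : ℕ :=
  sSup (Set.range fun j : ℤ => lamTildeM X F n (shiftIter j x))

/-- `Iₙ⁺(x) = min{s ≥ 0 : F^i(W_{-s}⁺(x)) ⊆ W₀⁺(F^i(x)) for all 1 ≤ i ≤ n}`. -/
def Iplus {A : Type*} (X : Set (ℤ → A)) (F : (ℤ → A) → (ℤ → A)) (n : ℕ)
    (x : ℤ → A) : ℕ :=
  sInf {s : ℕ | ∀ i : ℕ, 1 ≤ i → i ≤ n →
    F^[i] '' Wplus X (-(s : ℤ)) x ⊆ Wplus X 0 (F^[i] x)}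

/-- `Iₙ⁻(x) = min{s ≥ 0 : F^i(W_s⁻(x)) ⊆ W₀⁻(F^i(x)) for all 1 ≤ i ≤ n}`. -/
def Iminus {A : Type*} (X : Set (ℤ → A)) (F : (ℤ → A) → (ℤ → A)) (n : ℕ)
    (x : ℤ → A) : ℕ :=
  sInf {s : ℕ | ∀ i : ℕ, 1 ≤ i → i ≤ n →
    F^[i] '' Wminus X (s : ℤ) x ⊆ Wminus X 0 (F^[i] x)}

/-- Average Lyapunov exponent `I_μ⁺ = liminf_n (∫ Iₙ⁺ dμ) / n`. -/
def avgIplus {A : Type*} [MeasurableSpace A] (X : Set (ℤ → A))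
    (F : (ℤ → A) → (ℤ → A)) (μ : Measure (ℤ → A)) : ℝ :=
  Filter.liminf (fun n : ℕ => (∫ x, (Iplus X F n x : ℝ) ∂μ) / n) Filter.atTop

/-- Average Lyapunov exponent `I_μ⁻ = liminf_n (∫ Iₙ⁻ dμ) / n`. -/
def avgIminus {A : Type*} [MeasurableSpace A] (X : Set (ℤ → A))
    (F : (ℤ → A) → (ℤ → A)) (μ : Measure (ℤ → A)) : ℝ :=
  Filter.liminf (fun n : ℕ => (∫ x, (Iminus X F n x : ℝ) ∂μ) / n) Filter.atTop

/-- The topological support `S(μ)` of a measure `μ` on `ℤ → A`. -/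
def msupp {A : Type*} [TopologicalSpace A] [MeasurableSpace A]
    (μ : Measure (ℤ → A)) : Set (ℤ → A) :=
  {x | ∀ U : Set (ℤ → A), IsOpen U → x ∈ U → 0 < μ U}

/-- `x` is an equicontinuous point of `F` on `X`: for every `ε = 2^{-m}` there is a
`δ = 2^{-k}` such that points of `X` agreeing with `x` on coordinates `|j| ≤ k`
have all their `F`-iterates agreeing with those of `x` on coordinates `|j| ≤ m`. -/
def IsEquicontPt {A : Type*} (X : Set (ℤ → A)) (F : (ℤ → A) → (ℤ → A))
    (x : ℤ → A) : Prop :=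
  ∀ m : ℕ, ∃ k : ℕ, ∀ y ∈ X, (∀ j : ℤ, |j| ≤ (k : ℤ) → y j = x j) →
    ∀ n : ℕ, ∀ j : ℤ, |j| ≤ (m : ℤ) → F^[n] y j = F^[n] x j

/-- Entropy `H_μ(α) = ∑ -μ(A) log μ(A)` of the finite partition given by the
fibers of `α`. -/
def partEnt {Ω : Type*} [MeasurableSpace Ω] (μ : Measure Ω) {I : Type*} [Fintype I]
    (α : Ω → I) : ℝ :=
  ∑ i : I, Real.negMulLog (μ (α ⁻¹' {i})).toReal

/-- Metric entropy `h_μ(T, α)` of `T` relative to the finite partition `α`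
(the limit of the subadditive sequence `H_μ(α ∨ T⁻¹α ∨ … ∨ T^{-n}α)/(n+1)`
equals its infimum). -/
def entropyPart {Ω : Type*} [MeasurableSpace Ω] (μ : Measure Ω) (T : Ω → Ω)
    {k : ℕ} (α : Ω → Fin k) : ℝ :=
  ⨅ n : ℕ, partEnt μ (fun x (i : Fin (n + 1)) => α (T^[(i : ℕ)] x)) / (n + 1)

/-- Kolmogorov–Sinai metric entropy `h_μ(T)`: supremum of `h_μ(T, α)` over all
finite measurable partitions `α`. -/
def metricEntropy {Ω : Type*} [MeasurableSpace Ω] (μ : Measure Ω) (T : Ω → Ω) : ℝ :=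
  ⨆ p : {q : Σ k : ℕ, Ω → Fin k // Measurable q.2}, entropyPart μ T p.1.2

/-- `B ∈ A^{2k+1}` is a blocking word for `F` (with radius `r`): there are `i` with
`2i+1 ≥ r` and words `vₙ ∈ A^{2i+1}`, independent of `x`, such that every `x ∈ X`
with `x(-k,k) = B` satisfies `F^n(x)(-i,i) = vₙ` for all `n ≥ 1`. -/
def IsBlockingWord {A : Type*} (X : Set (ℤ → A)) (F : (ℤ → A) → (ℤ → A)) (r k : ℕ)
    (B : Fin (2 * k + 1) → A) : Prop :=
  ∃ i : ℕ, r ≤ 2 * i + 1 ∧ ∃ v : ℕ → Fin (2 * i + 1) → A,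
    ∀ x ∈ X, (∀ j : Fin (2 * k + 1), x (((j : ℕ) : ℤ) - (k : ℤ)) = B j) →
      ∀ n : ℕ, 1 ≤ n → ∀ j : Fin (2 * i + 1),
        F^[n] x (((j : ℕ) : ℤ) - (i : ℤ)) = v n j

/-- `D(n, 2^{-p})`: minimal cardinality of an `(n, 2^{-p})`-covering (spanning) set
for `F`, where closeness in the Bowen metric `d_n` up to `2^{-p}` means agreement of
all iterates `F^i`, `i ≤ n`, on the coordinates `|j| ≤ p`. -/
def coverNum {A : Type*} (F : (ℤ → A) → (ℤ → A)) (n p : ℕ) : ℕ :=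
  sInf {N : ℕ | ∃ S : Finset (ℤ → A), S.card ≤ N ∧ ∀ x : ℤ → A, ∃ y ∈ S,
    ∀ i : ℕ, i ≤ n → ∀ j : ℤ, |j| ≤ (p : ℤ) → F^[i] x j = F^[i] y j}

/-- Topological entropy `h_top(F) = lim_{ε→0} lim_n (1/n) log D(n, ε)`. -/
def htop {A : Type*} (F : (ℤ → A) → (ℤ → A)) : ℝ :=
  ⨆ p : ℕ, Filter.limsup (fun n : ℕ => Real.log (coverNum F n p) / n) Filter.atTop

end

/-- Shifts compose additively. -/
theorem shiftIter_shiftIter {A : Type*} (j k : ℤ) (x : ℤ → A) :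
    shiftIter j (shiftIter k x) = shiftIter (j + k) x := by
  funext i
  simp only [shiftIter, add_assoc]

/-- A `σ`-invariant set is invariant under all iterates of the shift and its inverse. -/
theorem shiftIter_mem {A : Type*} {X : Set (ℤ → A)} (hX : shiftMap A '' X = X) (j : ℤ)
    {x : ℤ → A} (hx : x ∈ X) : shiftIter j x ∈ X := by
  induction j with
  | zero => rwa [show shiftIter 0 x = x by funext i; simp [shiftIter]]
  | succ k ih =>
    rw [add_comm, ← shiftIter_shiftIter, ← hX]
    exact ⟨_, ih, rfl⟩
  | pred k ih =>
    rw [← hX] at ih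
    obtain ⟨y, hy, hyx⟩ := ih
    convert hy using 1
    rw [sub_eq_neg_add, ← shiftIter_shiftIter, ← hyx]
    funext i
    simp [shiftIter, shiftMap]

/-- Iterates of a map with a local rule commute with all iterates of the shift. -/
theorem HasLocalRule.iterate_shiftIter {A : Type*} {F : (ℤ → A) → (ℤ → A)} {r : ℕ}
    (hF : HasLocalRule F r) (n : ℕ) (j : ℤ) (x : ℤ → A) :
    F^[n] (shiftIter j x) = shiftIter j (F^[n] x) := by
  obtain ⟨f, hf⟩ := hF
  have h : Function.Commute F (shiftIter j) := fun x => by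
    funext i
    simp only [shiftIter, hf]
    congr 1
    funext k
    congr 1
    ring
  exact h.iterate_left n x

/-- The `n`-th iterate of a map with a local rule of radius `r` has radius `n * r`. -/
theorem HasLocalRule.iterate_apply_eq {A : Type*} {F : (ℤ → A) → (ℤ → A)} {r : ℕ}
    (hF : HasLocalRule F r) (n : ℕ) {x y : ℤ → A} (k : ℤ)
    (h : ∀ j : ℤ, k - (n * r : ℕ) ≤ j → j ≤ k + (n * r : ℕ) → y j = x j) :
    F^[n] y k = F^[n] x k := by
  obtain ⟨f, hf⟩ := hF
  induction n generalizing k with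
  | zero => exact h k (by simp) (by simp)
  | succ n ih =>
    rw [Function.iterate_succ_apply', Function.iterate_succ_apply', hf, hf]
    congr 1
    funext m
    have hm := m.isLt
    refine ih _ fun j h₁ h₂ => h j ?_ ?_ <;> rw [add_mul, one_mul] <;> omega

section Inequalities

variable {A : Type*} {X : Set (ℤ → A)} {F : (ℤ → A) → (ℤ → A)} {r : ℕ}

theorem mul_mem_lamTildeP_set (hFX : MapsTo F X X) (hF : HasLocalRule F r) (n : ℕ)
    (x : ℤ → A) :
    n * r ∈ {s : ℕ | ∀ i : ℕ, 1 ≤ i → i ≤ n →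
      F^[i] '' Wplus X 0 x ⊆ Wplus X (s : ℤ) (F^[i] x)} := by
  rintro i - hi _ ⟨y, ⟨hy, hyx⟩, rfl⟩
  have := Nat.mul_le_mul_right r hi
  exact ⟨hFX.iterate i hy, fun k hk =>
    hF.iterate_apply_eq i k fun j h₁ _ => hyx j (by omega)⟩

theorem mul_mem_lamTildeM_set (hFX : MapsTo F X X) (hF : HasLocalRule F r) (n : ℕ)
    (x : ℤ → A) :
    n * r ∈ {s : ℕ | ∀ i : ℕ, 1 ≤ i → i ≤ n →
      F^[i] '' Wminus X 0 x ⊆ Wminus X (-(s : ℤ)) (F^[i] x)} := by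
  rintro i - hi _ ⟨y, ⟨hy, hyx⟩, rfl⟩
  have := Nat.mul_le_mul_right r hi
  exact ⟨hFX.iterate i hy, fun k hk =>
    hF.iterate_apply_eq i k fun j _ h₂ => hyx j (by omega)⟩

theorem lamTildeP_le_lamP (hFX : MapsTo F X X) (hF : HasLocalRule F r) (n : ℕ)
    (x : ℤ → A) (j : ℤ) : lamTildeP X F n (shiftIter j x) ≤ lamP X F n x :=
  le_csSup ⟨n * r, by
    rintro _ ⟨k, rfl⟩
    exact Nat.sInf_le (mul_mem_lamTildeP_set hFX hF n _)⟩ ⟨j, rfl⟩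

theorem lamTildeM_le_lamM (hFX : MapsTo F X X) (hF : HasLocalRule F r) (n : ℕ)
    (x : ℤ → A) (j : ℤ) : lamTildeM X F n (shiftIter j x) ≤ lamM X F n x :=
  le_csSup ⟨n * r, by
    rintro _ ⟨k, rfl⟩
    exact Nat.sInf_le (mul_mem_lamTildeM_set hFX hF n _)⟩ ⟨j, rfl⟩

theorem Iplus_le_lamP (hX : shiftMap A '' X = X) (hFX : MapsTo F X X)
    (hF : HasLocalRule F r) (n : ℕ) (x : ℤ → A) : Iplus X F n x ≤ lamP X F n x := by
  refine Nat.sInf_le ?_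
  rintro i h₁ hi _ ⟨y, ⟨hy, hyx⟩, rfl⟩
  refine ⟨hFX.iterate i hy, fun k hk => ?_⟩
  set L := lamP X F n x
  have hle : lamTildeP X F n (shiftIter (-L) x) ≤ L := lamTildeP_le_lamP hFX hF n x _
  have hmem := Nat.sInf_mem ⟨_, mul_mem_lamTildeP_set hFX hF n (shiftIter (-L) x)⟩ i h₁ hi
    ⟨shiftIter (-L) y, ⟨shiftIter_mem hX _ hy, fun m hm => hyx _ (by omega)⟩, rfl⟩
  rw [← lamTildeP, hF.iterate_shiftIter, hF.iterate_shiftIter] at hmem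
  simpa [shiftIter] using hmem.2 (k + L) (by omega)

theorem Iminus_le_lamM (hX : shiftMap A '' X = X) (hFX : MapsTo F X X)
    (hF : HasLocalRule F r) (n : ℕ) (x : ℤ → A) : Iminus X F n x ≤ lamM X F n x := by
  refine Nat.sInf_le ?_
  rintro i h₁ hi _ ⟨y, ⟨hy, hyx⟩, rfl⟩
  refine ⟨hFX.iterate i hy, fun k hk => ?_⟩
  set L := lamM X F n x
  have hle : lamTildeM X F n (shiftIter L x) ≤ L := lamTildeM_le_lamM hFX hF n x _
  have hmem := Nat.sInf_mem ⟨_, mul_mem_lamTildeM_set hFX hF n (shiftIter L x)⟩ i h₁ hi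
    ⟨shiftIter L y, ⟨shiftIter_mem hX _ hy, fun m hm => hyx _ (by omega)⟩, rfl⟩
  rw [← lamTildeM, hF.iterate_shiftIter, hF.iterate_shiftIter] at hmem
  simpa [shiftIter] using hmem.2 (k - L) (by omega)

end Inequalities

/-- `Λₙ⁺(x) ≥ Iₙ⁺(x) − 1` and `Λₙ⁻(x) ≥ Iₙ⁻(x) − 1` (stated as
`Iₙ^±(x) ≤ Λₙ^±(x) + 1`). -/
theorem stmt3 {A : Type*} [Fintype A] [TopologicalSpace A] [DiscreteTopology A]
    (X : Set (ℤ → A)) (hXcl : IsClosed X) (hXσ : shiftMap A '' X = X)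
    (F : (ℤ → A) → (ℤ → A)) (hFX : Set.MapsTo F X X) (hFc : Continuous F)
    (hFσ : ∀ x, F (shiftMap A x) = shiftMap A (F x))
    (r : ℕ) (hr : 1 ≤ r) (hloc : HasLocalRule F r) :
    ∀ x ∈ X, ∀ n : ℕ, 1 ≤ n →
      Iplus X F n x ≤ lamP X F n x + 1 ∧ Iminus X F n x ≤ lamM X F n x + 1 := by
  intro x _ n _
  exact ⟨(Iplus_le_lamP hXσ hFX hloc n x).trans (Nat.le_succ _),
    (Iminus_le_lamM hXσ hFX hloc n x).trans (Nat.le_succ _)⟩
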